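/- Let C(a, b) = (2/(1 − b))^a + ( sec(aπ/2)/b^a ) · ( 4 + ( 2^{(1+a)/(1−a)} + 2^{(2+a)/(1−a)} )^{1−a} ). For a = 0.815508 and b = 0.845890 one has ( log C(a, b) + e^{−1} ) / a < 5.3078. -/

import Mathlib

/-- The constant `C(a, b)` from Lemma D:
`C(a,b) = (2/(1-b))^a + (sec(aπ/2)/b^a)(4 + (2^{(1+a)/(1-a)} + 2^{(2+a)/(1-a)})^{1-a})`. -/
noncomputable def Cconst (a b : ℝ) : ℝ :=
  (2 / (1 - b)) ^ a +
    ((Real.cos (a * Real.pi / 2))⁻¹ / b ^ a) *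
      (4 + ((2 : ℝ) ^ ((1 + a) / (1 - a)) + (2 : ℝ) ^ ((2 + a) / (1 - a))) ^ (1 - a))

open Finset in
theorem Real.le_exp_of_le_sum {x y : ℝ} (hx : 0 ≤ x) (n : ℕ)
    (h : y ≤ ∑ i ∈ range n, x ^ i / i.factorial) : y ≤ Real.exp x :=
  h.trans (Real.sum_le_exp_of_nonneg hx n)

open Finset in
theorem Real.exp_le_of_sum_le {x y : ℝ} (h0 : 0 ≤ x) (h1 : x ≤ 1) {n : ℕ} (hn : 0 < n)
    (h : ∑ i ∈ range n, x ^ i / i.factorial + x ^ n * (n + 1) / (n.factorial * n) ≤ y) :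
    Real.exp x ≤ y :=
  (Real.exp_bound' h0 h1 hn).trans h

theorem Real.rpow_le_exp_mul {x L a : ℝ} (hx : 0 ≤ x) (ha : 0 ≤ a) (h : x ≤ Real.exp L) :
    x ^ a ≤ Real.exp (L * a) := by
  rw [Real.exp_mul]
  exact Real.rpow_le_rpow hx h ha

theorem Real.exp_mul_le_rpow {x L a : ℝ} (ha : 0 ≤ a) (h : Real.exp L ≤ x) :
    Real.exp (L * a) ≤ x ^ a := by
  rw [Real.exp_mul]
  exact Real.rpow_le_rpow (Real.exp_pos _).le h ha

theorem rpow_two_div_le : ((2 : ℝ) / (1 - 0.845890)) ^ (0.815508 : ℝ) ≤ 8.08775 := by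
  have hbase : (2 : ℝ) / (1 - 0.845890) ≤ Real.exp 2.563237 := by
    apply Real.le_exp_of_le_sum (by norm_num) 20
    norm_num [Finset.sum_range_succ, Nat.factorial]
  have hexp : Real.exp (2.563237 * 0.815508 / 4) ≤ 1.686383 := by
    apply Real.exp_le_of_sum_le (n := 10) (by norm_num) (by norm_num) (by norm_num)
    norm_num [Finset.sum_range_succ, Nat.factorial]
  calc _ ≤ Real.exp (2.563237 * 0.815508) :=
        Real.rpow_le_exp_mul (by norm_num) (by norm_num) hbase
    _ = Real.exp (2.563237 * 0.815508 / 4) ^ 4 := by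
        rw [← Real.exp_nat_mul]
        norm_num
    _ ≤ 1.686383 ^ 4 := by gcongr
    _ ≤ 8.08775 := by norm_num

theorem le_rpow_base : (0.87241 : ℝ) ≤ (0.845890 : ℝ) ^ (0.815508 : ℝ) := by
  have hbase : Real.exp (-0.167366) ≤ 0.845890 := by
    rw [Real.exp_neg]
    apply inv_le_of_inv_le₀ (by norm_num)
    apply Real.le_exp_of_le_sum (by norm_num) 10
    norm_num [Finset.sum_range_succ, Nat.factorial]
  have hexp : Real.exp (0.167366 * 0.815508) ≤ (0.87241 : ℝ)⁻¹ := by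
    apply Real.exp_le_of_sum_le (n := 10) (by norm_num) (by norm_num) (by norm_num)
    norm_num [Finset.sum_range_succ, Nat.factorial]
  refine le_trans ?_ (Real.exp_mul_le_rpow (by norm_num) hbase)
  rw [neg_mul, Real.exp_neg]
  exact le_inv_of_le_inv₀ (Real.exp_pos _) hexp

theorem le_cos_mul_pi_div_two : (0.285759 : ℝ) ≤ Real.cos (0.815508 * Real.pi / 2) := by
  have hpi := Real.pi_gt_d6
  have hlower : (0.09644945 : ℝ) ≤ Real.sin 0.0965997 := by
    refine le_trans ?_ (Real.sin_ge_sub_cube (by norm_num))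
    norm_num
  have hupper : Real.sin 0.0965997 ≤ 0.0965997 := Real.sin_le (by norm_num)
  have hsin : (0.285759 : ℝ) ≤ Real.sin (3 * 0.0965997) := by
    rw [Real.sin_three_mul]
    nlinarith [mul_nonneg (sub_nonneg.2 hlower)
      (by nlinarith : 0 ≤ 3 - 4 * (Real.sin 0.0965997 ^ 2 + 0.09644945 * Real.sin 0.0965997 +
        0.09644945 ^ 2))]
  rw [← Real.sin_pi_div_two_sub]
  refine hsin.trans (Real.sin_le_sin_of_le_of_le_pi_div_two ?_ ?_ ?_) <;> linarith

set_option exponentiation.threshold 300 in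
theorem rpow_add_rpow_le :
    ((2 : ℝ) ^ ((1 + 0.815508 : ℝ) / (1 - 0.815508)) +
      (2 : ℝ) ^ ((2 + 0.815508 : ℝ) / (1 - 0.815508))) ^ (1 - 0.815508 : ℝ) ≤ 7.06979 := by
  set q : ℝ := (2 + 0.815508) / (1 - 0.815508) with hq
  have htwo : (2 : ℝ) ≤ Real.exp 0.6931471808 :=
    (Real.log_le_iff_le_exp (by norm_num)).1 Real.log_two_lt_d9.le
  have hfrac : (2 : ℝ) ^ (-5.42 : ℝ) ≤ 0.02336 := by
    have h : ((2 : ℝ) ^ (-5.42 : ℝ)) ^ 50 ≤ 0.02336 ^ 50 := by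
      rw [← Real.rpow_natCast, ← Real.rpow_mul (by norm_num),
        show (-5.42 : ℝ) * (50 : ℕ) = ((-271 : ℤ) : ℝ) by norm_num, Real.rpow_intCast]
      norm_num
    exact le_of_pow_le_pow_left₀ (by norm_num) (by norm_num) h
  have hp : (2 : ℝ) ^ ((1 + 0.815508 : ℝ) / (1 - 0.815508)) ≤ 0.02336 * 2 ^ q := by
    calc _ ≤ (2 : ℝ) ^ (-5.42 + q) := by
          apply Real.rpow_le_rpow_of_exponent_le (by norm_num)
          rw [hq]
          norm_num
      _ = (2 : ℝ) ^ (-5.42 : ℝ) * 2 ^ q := Real.rpow_add (by norm_num) _ _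
      _ ≤ _ := by gcongr
  have hone : (1.02336 : ℝ) ≤ Real.exp 0.023092 := by
    apply Real.le_exp_of_le_sum (by norm_num) 6
    norm_num [Finset.sum_range_succ, Nat.factorial]
  have hq0 : 0 ≤ q := by rw [hq]; norm_num
  have hsum : (2 : ℝ) ^ ((1 + 0.815508 : ℝ) / (1 - 0.815508)) + 2 ^ q ≤
      Real.exp (0.023092 + 0.6931471808 * q) := by
    rw [Real.exp_add]
    calc _ ≤ 1.02336 * (2 : ℝ) ^ q := by linarith
      _ ≤ _ := by
        gcongr
        exact Real.rpow_le_exp_mul (by norm_num) hq0 htwo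
  have hexp : Real.exp ((0.023092 + 0.6931471808 * q) * (1 - 0.815508) / 2) ≤ 2.6589 := by
    rw [hq]
    apply Real.exp_le_of_sum_le (n := 12) (by norm_num) (by norm_num) (by norm_num)
    norm_num [Finset.sum_range_succ, Nat.factorial]
  calc _ ≤ Real.exp ((0.023092 + 0.6931471808 * q) * (1 - 0.815508)) :=
        Real.rpow_le_exp_mul (by positivity) (by norm_num) hsum
    _ = Real.exp ((0.023092 + 0.6931471808 * q) * (1 - 0.815508) / 2) ^ 2 := by
        rw [← Real.exp_nat_mul]
        congr 1
        push_cast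
        ring
    _ ≤ 2.6589 ^ 2 := by gcongr
    _ ≤ 7.06979 := by norm_num

theorem Cconst_le : Cconst 0.815508 0.845890 ≤ 52.492 := by
  have hcos := le_cos_mul_pi_div_two
  have hbase := le_rpow_base
  calc Cconst 0.815508 0.845890
      ≤ 8.08775 + ((0.285759 : ℝ)⁻¹ / 0.87241) * (4 + 7.06979) := by
        unfold Cconst
        gcongr
        · exact rpow_two_div_le
        · exact rpow_add_rpow_le
    _ ≤ 52.492 := by norm_num

theorem Cconst_pos : 0 < Cconst 0.815508 0.845890 := by
  have hcos : (0 : ℝ) < Real.cos (0.815508 * Real.pi / 2) :=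
    lt_of_lt_of_le (by norm_num) le_cos_mul_pi_div_two
  unfold Cconst
  have : (0 : ℝ) < 2 / (1 - 0.845890) := by norm_num
  positivity

/-- Numerical estimate: for `a = 0.815508` and `b = 0.845890` one has
`(log C(a, b) + e⁻¹) / a < 5.3078`. -/
theorem Cconst_numerical_bound :
    (Real.log (Cconst 0.815508 0.845890) + (Real.exp 1)⁻¹) / 0.815508 < 5.3078 := by
  have hlog : Real.log (Cconst 0.815508 0.845890) ≤ 3.96067 := by
    rw [Real.log_le_iff_le_exp Cconst_pos]
    refine Cconst_le.trans (Real.le_exp_of_le_sum (by norm_num) 22 ?_)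
    norm_num [Finset.sum_range_succ, Nat.factorial]
  have hinv := Real.exp_neg_one_lt_d9
  rw [Real.exp_neg] at hinv
  rw [div_lt_iff₀ (by norm_num)]
  linarith
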